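/- TLV is a linear eroder with eroder constant m = 1 in the following precise form: for every finite nonempty set S ⊆ ℤ with diameter d = max S − min S, the configuration 1_S (true exactly on S, false elsewhere) satisfies TLV^t(1_S) = identically false for every t ≥ ⌊3d/4⌋ + 1; in particular TLV^t(1_S) is identically false for all t ≥ d + 1. -/

import Mathlib

/-- Boolean majority of three bits. -/
def maj3 (a b c : Bool) : Bool := (a && b) || (a && c) || (b && c)

/-- The two-line voting cellular automaton (TLV) in stretched form:
`(TLV x)_i = maj[x_{i-1}, x_{i+2}, x_{i+4}]` for even `i` and
`(TLV x)_i = maj[x_{i+1}, x_{i-2}, x_{i-4}]` for odd `i`. -/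
def TLV (x : ℤ → Bool) : ℤ → Bool := fun i =>
  if i % 2 = 0 then maj3 (x (i - 1)) (x (i + 2)) (x (i + 4))
  else maj3 (x (i + 1)) (x (i - 2)) (x (i - 4))

/-- Bounding invariant at time `t`. -/
def TInv (a b T t : ℤ) (x : ℤ → Bool) : Prop :=
  ∀ i, x i = true →
    (i % 2 = 0 → a - 2*t ≤ i ∧ i ≤ b - 2*t ∧ (T ≤ t → i ≤ b + 2*T - 4*t)) ∧
    (i % 2 ≠ 0 → a + 2*t ≤ i ∧ i ≤ b + 2*t ∧ (T ≤ t → a - 2*T + 4*t ≤ i))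

theorem maj3_cases {p q r : Bool} (h : maj3 p q r = true) :
    (p = true ∧ (q = true ∨ r = true)) ∨ (q = true ∧ r = true) := by
  revert h; cases p <;> cases q <;> cases r <;> simp [maj3]

theorem TInv_step {a b T t : ℤ} (ht : 0 ≤ t) (hT : b - a - 3 < 4 * T) {x : ℤ → Bool}
    (h : TInv a b T t x) : TInv a b T (t+1) (TLV x) := by
  intro i hi
  unfold TLV at hi
  by_cases hp : i % 2 = 0
  · rw [if_pos hp] at hi
    refine ⟨fun _ => ?_, fun h' => absurd hp h'⟩
    rcases maj3_cases hi with ⟨h1, h2 | h2⟩ | ⟨h1, h2⟩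
    all_goals
      have k1 := h _ h1
      have k2 := h _ h2
      omega
  · rw [if_neg hp] at hi
    refine ⟨fun h' => absurd h' hp, fun _ => ?_⟩
    rcases maj3_cases hi with ⟨h1, h2 | h2⟩ | ⟨h1, h2⟩
    all_goals
      have k1 := h _ h1
      have k2 := h _ h2
      omega

theorem TInv_iter {a b T : ℤ} (hT : b - a - 3 < 4 * T) {x : ℤ → Bool}
    (h : TInv a b T 0 x) (t : ℕ) : TInv a b T t (TLV^[t] x) := by
  induction t with
  | zero => simpa using h
  | succ n ih =>
    rw [Function.iterate_succ_apply']
    push_cast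
    exact TInv_step (by omega) hT ih

/-- TLV is a linear eroder (with eroder constant `m = 1`): every finite nonempty
cluster `S ⊆ ℤ` of diameter `d = max S - min S` on a background of zeros is erased
after at most `⌊3d/4⌋ + 1` time steps; in particular after at most `d + 1` steps. -/
theorem TLV_linear_eroder (S : Finset ℤ) (hS : S.Nonempty) :
    (∀ t : ℕ, 3 * (S.max' hS - S.min' hS).toNat / 4 + 1 ≤ t →
      TLV^[t] (fun i => decide (i ∈ S)) = fun _ => false)
    ∧ (∀ t : ℕ, (S.max' hS - S.min' hS).toNat + 1 ≤ t →
      TLV^[t] (fun i => decide (i ∈ S)) = fun _ => false) := by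
  have key : ∀ t : ℕ, 3 * (S.max' hS - S.min' hS).toNat / 4 + 1 ≤ t →
      TLV^[t] (fun i => decide (i ∈ S)) = fun _ => false := by
    intro t ht
    have hab : S.min' hS ≤ S.max' hS := S.min'_le _ (S.max'_mem hS)
    have h0 : TInv (S.min' hS) (S.max' hS) ((S.max' hS - S.min' hS + 1) / 4) 0
        (fun i => decide (i ∈ S)) := by
      intro i hi
      have hi' : i ∈ S := by simpa using hi
      have h1 := S.min'_le i hi'
      have h2 := S.le_max' i hi'
      omega
    have h := TInv_iter (by omega) h0 t
    funext i
    by_contra hne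
    have hi := h i (by simpa using hne)
    generalize S.max' hS = b at *
    generalize S.min' hS = a at *
    clear h h0 hne
    omega
  exact ⟨key, fun t ht => key t (by omega)⟩
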